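/- Let k ≥ 0 be an integer and let (b_1,…,b_s) be a k-Wahl chain. Set r = K(b_1,…,b_s) and a = K(b_2,…,b_s). Then there exists a dual k-Wahl chain (e_1,…,e_m) such that K(e_1,…,e_m) = r and K(e_2,…,e_m) = r − a; that is, the Hirzebruch–Jung continued fraction expansion of r/(r−a) is a dual k-Wahl chain. -/

import Mathlib

/-- The (negative/HJ) continuant: `contK [] = 1`, `contK [v] = v`,
`contK (v₁ :: v₂ :: rest) = v₁ * contK (v₂ :: rest) - contK rest`. -/
def contK : List ℤ → ℤ
  | [] => 1
  | [v] => v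
  | v :: w :: rest => v * contK (w :: rest) - contK rest

/-- `k`-Wahl chains: the smallest set of lists of integers containing `[k+2]`
and closed under `[b₁,…,bℓ] ↦ [b₁+1,b₂,…,bℓ,2]` and `[b₁,…,bℓ] ↦ [2,b₁,…,b_{ℓ-1},bℓ+1]`. -/
inductive IsKWahl (k : ℕ) : List ℤ → Prop
  | base : IsKWahl k [(k : ℤ) + 2]
  | right {b : ℤ} {t : List ℤ} : IsKWahl k (b :: t) → IsKWahl k ((b + 1) :: (t ++ [2]))
  | left {t : List ℤ} {b : ℤ} : IsKWahl k (t ++ [b]) → IsKWahl k (2 :: (t ++ [b + 1]))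

/-- Dual `k`-Wahl chains: the smallest set of lists of integers containing the list
of `k+1` twos and closed under the same two operations. -/
inductive IsDualKWahl (k : ℕ) : List ℤ → Prop
  | base : IsDualKWahl k (List.replicate (k + 1) 2)
  | right {b : ℤ} {t : List ℤ} : IsDualKWahl k (b :: t) → IsDualKWahl k ((b + 1) :: (t ++ [2]))
  | left {t : List ℤ} {b : ℤ} : IsDualKWahl k (t ++ [b]) → IsDualKWahl k (2 :: (t ++ [b + 1]))

/-- The remainder sequence: `rem l i = K(b_{i+1},…,b_s)` for `i ≤ s = l.length`
(so `rem l 0 = r`, `rem l 1 = a`, `rem l s = 1`), and `0` afterwards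
(so `rem l (s+1) = 0`). -/
def rem (l : List ℤ) (i : ℕ) : ℤ := if i ≤ l.length then contK (l.drop i) else 0

/-- Run-length encoding of a finite sequence: the lengths of its maximal blocks of
consecutive equal entries. -/
def rle : List ℤ → List ℕ
  | [] => []
  | [_] => [1]
  | a :: b :: t =>
    if a = b then
      match rle (b :: t) with
      | c :: cs => (c + 1) :: cs
      | [] => [1]
    else 1 :: rle (b :: t)

/-- The length encoding of special representations: the run-length encoding of the
difference sequence `(d₁,…,d_{s-1})` where `dᵢ = aᵢ - a_{i+1}`. -/
def LESR (l : List ℤ) : List ℕ :=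
  rle ((List.range (l.length - 1)).map fun i => rem l (i + 1) - rem l (i + 2))

/-- Add `c` to the first entry of a list. -/
def addHead (c : ℤ) : List ℤ → List ℤ
  | [] => []
  | a :: t => (a + c) :: t

/-- Add `c` to the last entry of a list. -/
def addLast (c : ℤ) : List ℤ → List ℤ
  | [] => []
  | [a] => [a + c]
  | a :: b :: t => a :: addLast c (b :: t)

/-- `(c₁,…,c_m)` is a length encoding of the `k`-Wahl chain `W`. -/
inductive IsLenEnc (k : ℕ) : List ℕ → List ℤ → Prop
  | base : IsLenEnc k [] [(k : ℤ) + 2]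
  | left {cs : List ℕ} {l : List ℤ} {c : ℕ} (hc : 0 < c)
      (h : IsLenEnc k cs l) (hhead : l.head? ≠ some 2) :
      IsLenEnc k (cs ++ [c]) (List.replicate c 2 ++ addLast (c : ℤ) l)
  | right {cs : List ℕ} {l : List ℤ} {c : ℕ} (hc : 0 < c)
      (h : IsLenEnc k cs l) (hlast : l.getLast? ≠ some 2) :
      IsLenEnc k (cs ++ [c]) (addHead (c : ℤ) l ++ List.replicate c 2)

/-- `kcf` is an admissible zero continued fraction for `b`: it has the same length,
`1 ≤ kᵢ ≤ bᵢ` entrywise, and its continuant vanishes. -/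
def IsAdmZCF (b kcf : List ℤ) : Prop :=
  List.Forall₂ (fun bi ki => 1 ≤ ki ∧ ki ≤ bi) b kcf ∧ contK kcf = 0

/-- The product of the matrices `!![v, -1; 1, 0]` over the entries `v` of a list. -/
def contMat (l : List ℤ) : Matrix (Fin 2) (Fin 2) ℤ :=
  (l.map fun v => !![v, -1; 1, 0]).prod

@[simp]
theorem contMat_nil : contMat [] = 1 := rfl

@[simp]
theorem contMat_cons (v : ℤ) (l : List ℤ) :
    contMat (v :: l) = !![v, -1; 1, 0] * contMat l := by
  simp [contMat]

@[simp]
theorem contMat_append (l₁ l₂ : List ℤ) : contMat (l₁ ++ l₂) = contMat l₁ * contMat l₂ := by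
  simp [contMat]

theorem contMat_zero_zero (l : List ℤ) : contMat l 0 0 = contK l := by
  induction l using contK.induct with
  | case1 => simp [contK]
  | case2 v => simp [contK]
  | case3 v w rest ih₁ ih₂ =>
    rw [contK, ← ih₁, ← ih₂]
    simp [Matrix.mul_apply, Matrix.vecMul, dotProduct, Fin.sum_univ_two]
    ring

theorem contMat_one_zero {l : List ℤ} (hl : l ≠ []) : contMat l 1 0 = contK l.tail := by
  obtain ⟨v, t, rfl⟩ := List.exists_cons_of_ne_nil hl
  simp [Matrix.mul_apply, Fin.sum_univ_two, contMat_zero_zero]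

theorem contMat_cons_add_one (v : ℤ) (l : List ℤ) :
    contMat ((v + 1) :: l) = !![1, 1; 0, 1] * contMat (v :: l) := by
  rw [contMat_cons, contMat_cons, ← mul_assoc, Matrix.mul_fin_two]
  simp

theorem contMat_concat_add_one (l : List ℤ) (v : ℤ) :
    contMat (l ++ [v + 1]) = contMat (l ++ [v]) * !![1, 0; -1, 1] := by
  simp [mul_assoc]

theorem contMat_right (b : ℤ) (t : List ℤ) :
    contMat ((b + 1) :: (t ++ [2])) =
      !![1, 1; 0, 1] * contMat (b :: t) * !![2, -1; 1, 0] := by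
  rw [contMat_cons_add_one, ← List.cons_append, contMat_append, mul_assoc]
  simp

theorem contMat_left (t : List ℤ) (b : ℤ) :
    contMat (2 :: (t ++ [b + 1])) =
      !![2, -1; 1, 0] * contMat (t ++ [b]) * !![1, 0; -1, 1] := by
  rw [contMat_cons, contMat_concat_add_one, mul_assoc]

theorem contMat_replicate_two (n : ℕ) :
    contMat (List.replicate n 2) = !![(n : ℤ) + 1, -n; n, 1 - n] := by
  induction n with
  | zero => simp [Matrix.one_fin_two]
  | succ n ih =>
    rw [List.replicate_succ, contMat_cons, ih, Matrix.mul_fin_two]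
    push_cast
    congr! 3 <;> ring_nf

theorem IsKWahl.ne_nil {k : ℕ} {b : List ℤ} (h : IsKWahl k b) : b ≠ [] := by
  cases h <;> simp

theorem IsDualKWahl.ne_nil {k : ℕ} {e : List ℤ} (h : IsDualKWahl k e) : e ≠ [] := by
  cases h <;> simp

/-- Duality at the level of continuant matrices: the matrix `!![r, -d; a, -c]` is sent
to `!![r, -(r - d); r - a, -(r - a - d + c)]`. -/
theorem IsKWahl.exists_dual_contMat {k : ℕ} {b : List ℤ} (h : IsKWahl k b) :
    ∃ e, IsDualKWahl k e ∧
      contMat e = !![1, 0; 1, -1] * contMat b * !![1, -1; 0, -1] := by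
  induction h with
  | base =>
    refine ⟨_, .base, ?_⟩
    rw [contMat_replicate_two]
    simp only [contMat_cons, contMat_nil, mul_one, Matrix.mul_fin_two]
    push_cast
    congr! 3 <;> ring_nf
  | @right b t _ ih =>
    obtain ⟨e, he, hM⟩ := ih
    obtain rfl | ⟨u, c, rfl⟩ := e.eq_nil_or_concat'
    · exact absurd rfl he.ne_nil
    refine ⟨_, he.left, ?_⟩
    have hP : (!![2, -1; 1, 0] * !![1, 0; 1, -1] : Matrix (Fin 2) (Fin 2) ℤ) =
        !![1, 0; 1, -1] * !![1, 1; 0, 1] := by decide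
    have hQ : (!![1, -1; 0, -1] * !![1, 0; -1, 1] : Matrix (Fin 2) (Fin 2) ℤ) =
        !![2, -1; 1, 0] * !![1, -1; 0, -1] := by decide
    rw [contMat_left, hM, contMat_right]
    simp only [mul_assoc, hQ]
    simp only [← mul_assoc, hP]
  | @left t b _ ih =>
    obtain ⟨e, he, hM⟩ := ih
    obtain ⟨c, u, rfl⟩ := List.exists_cons_of_ne_nil he.ne_nil
    refine ⟨_, he.right, ?_⟩
    have hP : (!![1, 1; 0, 1] * !![1, 0; 1, -1] : Matrix (Fin 2) (Fin 2) ℤ) =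
        !![1, 0; 1, -1] * !![2, -1; 1, 0] := by decide
    have hQ : (!![1, -1; 0, -1] * !![2, -1; 1, 0] : Matrix (Fin 2) (Fin 2) ℤ) =
        !![1, 0; -1, 1] * !![1, -1; 0, -1] := by decide
    rw [contMat_right, hM, contMat_left]
    simp only [mul_assoc, hQ]
    simp only [← mul_assoc, hP]

/-- If `(b₁,…,b_s)` is a `k`-Wahl chain with `r = K(b₁,…,b_s)` and `a = K(b₂,…,b_s)`,
then the HJ continued fraction expansion of `r/(r-a)` is a dual `k`-Wahl chain. -/
theorem kWahl_dual_expansion (k : ℕ) (b : List ℤ) (h : IsKWahl k b) :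
    ∃ e : List ℤ, IsDualKWahl k e ∧ contK e = contK b ∧
      contK e.tail = contK b - contK b.tail := by
  obtain ⟨e, he, hM⟩ := h.exists_dual_contMat
  refine ⟨e, he, ?_, ?_⟩
  · rw [← contMat_zero_zero, ← contMat_zero_zero, hM]
    simp [Matrix.mul_apply, Matrix.vecMul, dotProduct, Fin.sum_univ_two]
  · rw [← contMat_one_zero he.ne_nil, ← contMat_one_zero h.ne_nil, ← contMat_zero_zero, hM]
    simp [Matrix.mul_apply, Matrix.vecMul, dotProduct, Fin.sum_univ_two]
    ring
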